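/- Let (X,𝒦) be a finite connectivity space with its Grothendieck topology J on the poset category (𝒦,⊆), where a sieve σ on A ∈ 𝒦 is covering iff [σ̇] = 𝒦 ∩ 𝒫(A). Then there is an equivalence of categories between the category of sheaves of types on the site (𝒦,J) and the category of presheaves of types on the poset (Irr_{(X,𝒦)},⊆) of irreducible connected sets, i.e. the functor category from (Irr_{(X,𝒦)},⊆)ᵒᵖ to the category of types. -/

import Mathlib

open CategoryTheory

/-- A connectivity structure on `X`: contains `∅`, and is stable under unions of
families with nonempty intersection. -/
def IsConnStruct {X : Type} (K : Set (Set X)) : Prop :=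
  ∅ ∈ K ∧ ∀ S : Set (Set X), S ⊆ K → (⋂₀ S).Nonempty → ⋃₀ S ∈ K

/-- The connectivity structure generated by a collection `C` of subsets of `X`. -/
def genConn {X : Type} (C : Set (Set X)) : Set (Set X) :=
  ⋂₀ {L | IsConnStruct L ∧ C ⊆ L}

/-- The set of irreducible connected sets of a connectivity space `(X, K)`. -/
def Irr {X : Type} (K : Set (Set X)) : Set (Set X) :=
  {A ∈ K | A ∉ genConn (K \ {A})}

/-- The set `σ̇` of elements of a sieve `σ` on `A` in the poset category `𝒦`. -/
def sieveSet {X : Type} {K : Set (Set X)} {A : ↥K} (σ : Sieve A) : Set (Set X) :=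
  {B | ∃ (hB : B ∈ K) (hle : (⟨B, hB⟩ : ↥K) ≤ A), σ.arrows (homOfLE hle)}

theorem isConnStruct_genConn {X : Type} (C : Set (Set X)) : IsConnStruct (genConn C) := by
  constructor
  · intro L hL
    exact hL.1.1
  · intro S hS hne L hL
    exact hL.1.2 S (fun c hc => hS hc L hL) hne

theorem subset_genConn {X : Type} (C : Set (Set X)) : C ⊆ genConn C :=
  fun _ hc _ hL => hL.2 hc

theorem isConnStruct_inter {X : Type} {K : Set (Set X)} (hK : IsConnStruct K) (A : Set X) :
    IsConnStruct (K ∩ Set.powerset A) := by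
  refine ⟨⟨hK.1, Set.empty_subset _⟩, fun S hS hne => ⟨hK.2 S (fun c hc => (hS hc).1) hne, ?_⟩⟩
  exact Set.sUnion_subset fun c hc => (hS hc).2

/-- The inclusion of the irreducibles. -/
def irrIncl {X : Type} (K : Set (Set X)) : ↥(Irr K) ⥤ ↥K :=
  Monotone.functor (f := fun I : ↥(Irr K) => (⟨I.1, I.2.1⟩ : ↥K)) (fun _ _ h => h)

instance {X : Type} (K : Set (Set X)) : (irrIncl K).Full where
  map_surjective {I I'} f := ⟨homOfLE (show I.1 ≤ I'.1 from leOfHom f), Subsingleton.elim _ _⟩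

instance {X : Type} (K : Set (Set X)) : (irrIncl K).Faithful where
  map_injective _ := Subsingleton.elim _ _

theorem irr_coverDense {X : Type} [Finite X] (K : Set (Set X)) (hK : IsConnStruct K)
    (J : GrothendieckTopology ↥K)
    (hJ : ∀ (A : ↥K) (σ : Sieve A),
      σ ∈ J A ↔ genConn (sieveSet σ) = K ∩ Set.powerset A.1) :
    (irrIncl K).IsCoverDense J where
  is_cover A := by
    rw [hJ]
    apply Set.Subset.antisymm
    · intro B hB
      refine hB _ ⟨isConnStruct_inter hK _, ?_⟩
      rintro C ⟨hC, hle, -⟩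
      exact ⟨hC, hle⟩
    · rintro B ⟨hB, hBA⟩
      induction B using WellFoundedLT.induction with
      | _ B ih =>
      by_cases hI : B ∈ Irr K
      · apply subset_genConn
        exact ⟨hB, hBA, ⟨⟨⟨B, hI⟩, 𝟙 _, homOfLE hBA, Subsingleton.elim _ _⟩⟩⟩
      · have h : B ∈ genConn (K \ {B}) := by
          by_contra h
          exact hI ⟨hB, h⟩
        refine h {C | C ⊆ B → C ∈ genConn (sieveSet (Sieve.coverByImage (irrIncl K) A))}
          ⟨⟨fun _ => (isConnStruct_genConn _).1, fun S hS hne hU => ?_⟩, ?_⟩ subset_rfl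
        · exact (isConnStruct_genConn _).2 S
            (fun c hc => hS hc ((Set.subset_sUnion_of_mem hc).trans hU)) hne
        · rintro C ⟨hC, hne⟩ hCB
          exact ih C (lt_of_le_of_ne hCB hne) hC (hCB.trans hBA)

theorem irr_dense {X : Type} [Finite X] (K : Set (Set X)) (hK : IsConnStruct K)
    (J : GrothendieckTopology ↥K)
    (hJ : ∀ (A : ↥K) (σ : Sieve A),
      σ ∈ J A ↔ genConn (sieveSet σ) = K ∩ Set.powerset A.1) :
    (irrIncl K).IsDenseSubsite ⊥ J where
  isCoverDense' := irr_coverDense K hK J hJ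
  functorPushforward_mem_iff {I S} := by
    rw [GrothendieckTopology.bot_covering]
    constructor
    · intro h
      rw [hJ] at h
      by_contra hS
      apply I.2.2
      have hI : I.1 ∈ genConn (sieveSet (S.functorPushforward (irrIncl K))) := by
        rw [h]; exact ⟨I.2.1, fun _ hx => hx⟩
      intro L hL
      refine hI L ⟨hL.1, fun C hC => hL.2 ?_⟩
      obtain ⟨hC, hle, Z, g, k, hg, -⟩ := hC
      refine ⟨hC, fun hCI => hS ?_⟩
      have hCI : C = I.1 := hCI
      subst hCI
      rw [← Sieve.id_mem_iff_eq_top]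
      have : S.arrows (homOfLE (show I ≤ Z from leOfHom k) ≫ g) := S.downward_closed hg _
      rwa [Subsingleton.elim (𝟙 I) (homOfLE (show I ≤ Z from leOfHom k) ≫ g)]
    · rintro rfl
      rw [Sieve.functorPushforward_top]
      exact J.top_mem _

theorem stmt9 {X : Type} [Finite X] (K : Set (Set X)) (hK : IsConnStruct K)
    (J : GrothendieckTopology ↥K)
    (hJ : ∀ (A : ↥K) (σ : Sieve A),
      σ ∈ J A ↔ genConn (sieveSet σ) = K ∩ Set.powerset A.1) :
    Nonempty (Sheaf J (Type) ≌ ((↥(Irr K))ᵒᵖ ⥤ Type)) := by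
  haveI := irr_dense K hK J hJ
  exact ⟨(Functor.IsDenseSubsite.sheafEquiv ⊥ J (irrIncl K) Type).symm.trans
    (sheafBotEquivalence _)⟩
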